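/- Let p, q be integers with 0 < p < q, let d ≥ 0, let Tlen, Slen > 0 and Qlen > 0 be real numbers, and let dT, dS, D be vectors in ℝ^m. Assume ‖D‖ ≤ Qlen, ‖D − p·dT − (q−p)·dS‖ ≤ 4qd + 5q, and |Qlen − p·Tlen − (q−p)·Slen| ≤ 4qd + 5q. Set s = p·Tlen / (p·Tlen + (q−p)·Slen). Then ‖ D/Qlen − s·(dT/Tlen) − (1−s)·(dS/Slen) ‖ ≤ (8d + 10)·q / (p·Tlen + (q−p)·Slen). -/

import Mathlib

noncomputable section

/-- Euclidean space `ℝ^m`. -/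
abbrev E (m : ℕ) := EuclideanSpace ℝ (Fin m)

/-- **Key estimate in the proof of Theorem 4.1 (convexity of the admissible rotation
set).** -/
theorem rotation_vector_estimate (m : ℕ) (p q : ℤ) (hp : 0 < p) (hpq : p < q)
    (d : ℝ) (hd : 0 ≤ d)
    (Tlen Slen Qlen : ℝ) (hT : 0 < Tlen) (hS : 0 < Slen) (hQ : 0 < Qlen)
    (dT dS D : E m)
    (hDQ : ‖D‖ ≤ Qlen)
    (hdisp : ‖D - (p : ℝ) • dT - ((q : ℝ) - (p : ℝ)) • dS‖ ≤ 4 * q * d + 5 * q)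
    (hlen : |Qlen - (p : ℝ) * Tlen - ((q : ℝ) - (p : ℝ)) * Slen| ≤ 4 * q * d + 5 * q) :
    ‖(Qlen⁻¹ • D) -
        ((p : ℝ) * Tlen / ((p : ℝ) * Tlen + ((q : ℝ) - (p : ℝ)) * Slen)) • (Tlen⁻¹ • dT) -
        (1 - (p : ℝ) * Tlen / ((p : ℝ) * Tlen + ((q : ℝ) - (p : ℝ)) * Slen)) •
          (Slen⁻¹ • dS)‖ ≤
      (8 * d + 10) * (q : ℝ) / ((p : ℝ) * Tlen + ((q : ℝ) - (p : ℝ)) * Slen) := by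
  have hL : 0 < (p : ℝ) * Tlen + ((q : ℝ) - (p : ℝ)) * Slen := by
    have hp' : (0 : ℝ) < p := by exact_mod_cast hp
    have hr : (0 : ℝ) < (q : ℝ) - p := sub_pos.mpr (by exact_mod_cast hpq)
    positivity
  have hlen' : |(p : ℝ) * Tlen + ((q : ℝ) - (p : ℝ)) * Slen - Qlen| ≤ 4 * q * d + 5 * q := by
    rw [abs_sub_comm, ← sub_sub]
    exact hlen
  set L := (p : ℝ) * Tlen + ((q : ℝ) - (p : ℝ)) * Slen with hLdef
  have key : (Qlen⁻¹ • D) - ((p : ℝ) * Tlen / L) • (Tlen⁻¹ • dT) -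
      (1 - (p : ℝ) * Tlen / L) • (Slen⁻¹ • dS) =
      L⁻¹ • ((D - (p : ℝ) • dT - ((q : ℝ) - (p : ℝ)) • dS) + ((L - Qlen) / Qlen) • D) := by
    have hT_coeff : (p : ℝ) * Tlen / L * Tlen⁻¹ = L⁻¹ * p := by field_simp
    have hS_coeff : (1 - (p : ℝ) * Tlen / L) * Slen⁻¹ = L⁻¹ * ((q : ℝ) - p) := by
      field_simp
      rw [hLdef]
      ring
    have hD_coeff : Qlen⁻¹ = L⁻¹ + L⁻¹ * ((L - Qlen) / Qlen) := by
      field_simp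
      ring
    rw [smul_smul, smul_smul, hT_coeff, hS_coeff, hD_coeff]
    module
  have hcorr : ‖((L - Qlen) / Qlen) • D‖ ≤ 4 * q * d + 5 * q := by
    rw [norm_smul, Real.norm_eq_abs, abs_div, abs_of_pos hQ]
    calc |L - Qlen| / Qlen * ‖D‖ ≤ |L - Qlen| / Qlen * Qlen := by gcongr
      _ = |L - Qlen| := div_mul_cancel₀ _ hQ.ne'
      _ ≤ 4 * q * d + 5 * q := hlen'
  rw [key, norm_smul, Real.norm_of_nonneg (inv_nonneg.mpr hL.le), inv_mul_eq_div]
  gcongr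
  linarith [norm_add_le_of_le hdisp hcorr]
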